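/- arXiv:2303.10525 — 2 statements merged into one kernel-verified Lean document; each statement's English description precedes it below -/
import Mathlib

section
/- Fix a dimension d ≥ 1 and let κ : [0,∞) → [0,∞) be a non-increasing continuous function such that ∫_{ℝ^d} κ(‖x‖₂) dx = 1, and such that there exist constants t₀ ≥ 1, C_ρ > 0 and 0 < ρ ≤ 1 with κ(t) ≤ C_ρ exp(−t^ρ) for all t > t₀. Set a = (d+1)/ρ, t₁ = max( Γ(a+1)^{1/(ρ(a−1))}, t₀ ), v_d = π^{d/2}/Γ(d/2+1), C₁ = ρ^{−1} C_ρ v_d 2^{a−1}, and k = ⌈(5+d)/ρ⌉ − 1. For h > 0 define K_h(x, y) = h^{−d} κ(‖x − y‖₂/h). Then for every x ∈ ℝ^d and every r ≥ t₁ h, ∫_{B(x,r)} K_h(x, y) dy ≥ 1 − C₁ · k! / (r/h)^4, where B(x,r) is the open Euclidean ball of radius r around x. In particular, if 0 < h ≤ h₀ = min( 1/(C₁ k!), 1/t₁² ), then taking r = √h gives ∫_{B(x,√h)} K_h(x, y) dy ≥ 1 − h. -/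
open MeasureTheory ENNReal
open scoped BigOperators

open Module in
/-- Scaling of the Lebesgue integral with respect to a Haar measure. -/
theorem lintegral_comp_smul_addHaar {E : Type*} [NormedAddCommGroup E] [NormedSpace ℝ E]
    [MeasurableSpace E] [BorelSpace E] [FiniteDimensional ℝ E] (μ : Measure E) [μ.IsAddHaarMeasure]
    (f : E → ℝ≥0∞) {c : ℝ} (hc : c ≠ 0) :
    ∫⁻ x, f (c • x) ∂μ = ENNReal.ofReal |(c ^ finrank ℝ E)⁻¹| * ∫⁻ x, f x ∂μ := by
  let e : E ≃ᵐ E := (Homeomorph.smul (Units.mk0 c hc)).toMeasurableEquiv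
  calc ∫⁻ x, f (c • x) ∂μ = ∫⁻ x, f x ∂(Measure.map e μ) := (lintegral_map_equiv f e).symm
    _ = _ := by
      have : Measure.map e μ = ENNReal.ofReal |(c ^ finrank ℝ E)⁻¹| • μ :=
        Measure.map_addHaar_smul μ hc
      rw [this, lintegral_smul_measure, smul_eq_mul]

/-- The mass of the rescaled radial kernel on `B(x, r)` is the mass of the kernel on `B(0, r / h)`. -/
theorem setLIntegral_ball_rescaled_radial {d : ℕ} (κ : ℝ → ℝ) {h : ℝ} (hh : 0 < h)
    (x : EuclideanSpace ℝ (Fin d)) (r : ℝ) :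
    ∫⁻ y in Metric.ball x r, ENNReal.ofReal (κ (‖x - y‖ / h) / h ^ d) =
      ∫⁻ z in Metric.ball (0 : EuclideanSpace ℝ (Fin d)) (r / h), ENNReal.ofReal (κ ‖z‖) := by
  set G : EuclideanSpace ℝ (Fin d) → ℝ≥0∞ :=
    (Metric.ball 0 (r / h)).indicator fun z ↦ ENNReal.ofReal (κ ‖z‖) with hG
  have hpt (y : EuclideanSpace ℝ (Fin d)) :
      (Metric.ball x r).indicator (fun y ↦ ENNReal.ofReal (κ (‖x - y‖ / h) / h ^ d)) y =
        ENNReal.ofReal (h ^ d)⁻¹ * G (h⁻¹ • (x - y)) := by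
    have hn : ‖h⁻¹ • (x - y)‖ = ‖x - y‖ / h := by
      rw [norm_smul, Real.norm_of_nonneg (inv_nonneg.2 hh.le)]; ring
    have hmem : y ∈ Metric.ball x r ↔ h⁻¹ • (x - y) ∈ Metric.ball 0 (r / h) := by
      rw [mem_ball_zero_iff, hn, div_lt_div_iff_of_pos_right hh, Metric.mem_ball', dist_eq_norm]
    by_cases hy : y ∈ Metric.ball x r
    · rw [Set.indicator_of_mem hy, hG, Set.indicator_of_mem (hmem.1 hy), hn,
        ← ENNReal.ofReal_mul (by positivity), div_eq_inv_mul (κ _)]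
    · rw [Set.indicator_of_notMem hy, hG, Set.indicator_of_notMem (mt hmem.2 hy), mul_zero]
  rw [← lintegral_indicator Metric.isOpen_ball.measurableSet, lintegral_congr hpt,
    lintegral_const_mul' _ _ ENNReal.ofReal_ne_top,
    lintegral_sub_left_eq_self (fun z ↦ G (h⁻¹ • z)) x,
    lintegral_comp_smul_addHaar _ _ (inv_ne_zero hh.ne'), ← mul_assoc,
    ← ENNReal.ofReal_mul (by positivity), finrank_euclideanSpace_fin,
    abs_of_pos (by positivity), inv_pow, inv_inv, inv_mul_cancel₀ (by positivity),
    ENNReal.ofReal_one, one_mul, lintegral_indicator Metric.isOpen_ball.measurableSet]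

open Module in
/-- Radial moments of the stretched exponential. -/
theorem integrable_norm_pow_mul_exp_neg_norm_rpow {E : Type*} [NormedAddCommGroup E]
    [NormedSpace ℝ E] [MeasurableSpace E] [BorelSpace E] [FiniteDimensional ℝ E] [Nontrivial E]
    (μ : Measure E) [μ.IsAddHaarMeasure] (m : ℕ) {ρ : ℝ} (hρ : 0 < ρ) :
    Integrable (fun x ↦ ‖x‖ ^ m * Real.exp (-‖x‖ ^ ρ)) μ ∧
      ∫ x, ‖x‖ ^ m * Real.exp (-‖x‖ ^ ρ) ∂μ =
        finrank ℝ E * μ.real (Metric.ball 0 1) *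
          (ρ⁻¹ * Real.Gamma ((finrank ℝ E + m) / ρ)) := by
  have hd : 0 < finrank ℝ E := finrank_pos
  have hq : (-1 : ℝ) < (finrank ℝ E - 1 + m : ℕ) := by
    have : (0 : ℝ) ≤ (finrank ℝ E - 1 + m : ℕ) := Nat.cast_nonneg _
    linarith
  have hpt (t : ℝ) : t ^ (finrank ℝ E - 1) • (t ^ m * Real.exp (-t ^ ρ)) =
      t ^ ((finrank ℝ E - 1 + m : ℕ) : ℝ) * Real.exp (-t ^ ρ) := by
    rw [Real.rpow_natCast, pow_add, smul_eq_mul, mul_assoc]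
  constructor
  · rw [integrable_fun_norm_addHaar μ (f := fun t ↦ t ^ m * Real.exp (-t ^ ρ))]
    simp_rw [hpt]
    exact integrableOn_rpow_mul_exp_neg_rpow hq hρ
  · rw [integral_fun_norm_addHaar μ (fun t ↦ t ^ m * Real.exp (-t ^ ρ))]
    simp_rw [hpt]
    rw [integral_rpow_mul_exp_neg_rpow hρ hq]
    have : (((finrank ℝ E - 1 + m : ℕ) : ℝ) + 1) = finrank ℝ E + m := by
      rw [← Nat.cast_add_one, ← Nat.cast_add]; congr 1; lia
    rw [this, nsmul_eq_mul, smul_eq_mul, one_div, mul_assoc]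

/-- `Γ` is bounded by a factorial. -/
theorem Gamma_le_factorial_ceil_sub_one {u v : ℝ} (hu : 2 ≤ u) (huv : u ≤ v) :
    Real.Gamma u ≤ (Nat.factorial (⌈v⌉₊ - 1) : ℝ) := by
  have hv : v ≤ (⌈v⌉₊ : ℝ) := Nat.le_ceil v
  have hpos : 1 ≤ ⌈v⌉₊ := Nat.one_le_ceil_iff.2 (by linarith)
  have hcast : ((⌈v⌉₊ - 1 : ℕ) : ℝ) + 1 = ⌈v⌉₊ := by
    rw [Nat.cast_sub hpos]; simp
  rw [← Real.Gamma_nat_eq_factorial, hcast]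
  exact Real.Gamma_strictMonoOn_Ici.monotoneOn hu (hu.trans (huv.trans hv)) (huv.trans hv)

/-- A probability density `κ ‖x‖` with tails bounded by `C exp (-‖x‖ ^ ρ)` outside radius `t₀`
has mass at least `1 - M C / s ^ m` on `B(0, s)` for `s ≥ t₀`, where `M` is the `m`-th moment of
`exp (-‖x‖ ^ ρ)`. -/
theorem one_sub_le_setLIntegral_ball_of_tail {E : Type*} [NormedAddCommGroup E]
    [NormedSpace ℝ E] [MeasurableSpace E] [BorelSpace E] [FiniteDimensional ℝ E] [Nontrivial E]
    (μ : Measure E) [μ.IsAddHaarMeasure] {κ : ℝ → ℝ} (hnorm : ∫⁻ x, ENNReal.ofReal (κ ‖x‖) ∂μ = 1)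
    {t₀ C ρ : ℝ} (ht₀ : 0 < t₀) (hC : 0 ≤ C) (hρ : 0 < ρ)
    (htail : ∀ t, t₀ ≤ t → κ t ≤ C * Real.exp (-t ^ ρ)) (m : ℕ) {s : ℝ} (hs : t₀ ≤ s) :
    ENNReal.ofReal (1 - C * (∫ x, ‖x‖ ^ m * Real.exp (-‖x‖ ^ ρ) ∂μ) / s ^ m) ≤
      ∫⁻ x in Metric.ball 0 s, ENNReal.ofReal (κ ‖x‖) ∂μ := by
  have hs0 : 0 < s := ht₀.trans_le hs
  set g : E → ℝ := fun x ↦ C / s ^ m * (‖x‖ ^ m * Real.exp (-‖x‖ ^ ρ)) with hg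
  have hg0 : ∀ x, 0 ≤ g x := fun x ↦ by positivity
  have hgint : Integrable g μ :=
    (integrable_norm_pow_mul_exp_neg_norm_rpow μ m hρ).1.const_mul _
  have hout : ∫⁻ x in (Metric.ball 0 s)ᶜ, ENNReal.ofReal (κ ‖x‖) ∂μ ≤
      ENNReal.ofReal (C * (∫ x, ‖x‖ ^ m * Real.exp (-‖x‖ ^ ρ) ∂μ) / s ^ m) := by
    calc ∫⁻ x in (Metric.ball 0 s)ᶜ, ENNReal.ofReal (κ ‖x‖) ∂μ
        ≤ ∫⁻ x in (Metric.ball 0 s)ᶜ, ENNReal.ofReal (g x) ∂μ := by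
          refine setLIntegral_mono' Metric.isOpen_ball.measurableSet.compl fun x hx ↦ ?_
          have hx' : s ≤ ‖x‖ := by simpa using hx
          refine ENNReal.ofReal_le_ofReal ((htail _ (hs.trans hx')).trans ?_)
          have h1 : 1 ≤ ‖x‖ ^ m / s ^ m :=
            (one_le_div (by positivity)).2 (pow_le_pow_left₀ hs0.le hx' m)
          calc C * Real.exp (-‖x‖ ^ ρ)
              ≤ (‖x‖ ^ m / s ^ m) * (C * Real.exp (-‖x‖ ^ ρ)) :=
                le_mul_of_one_le_left (by positivity) h1
            _ = g x := by rw [hg]; ring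
      _ ≤ ∫⁻ x, ENNReal.ofReal (g x) ∂μ := setLIntegral_le_lintegral _ _
      _ = ENNReal.ofReal (∫ x, g x ∂μ) :=
          (ofReal_integral_eq_lintegral_ofReal hgint (ae_of_all _ hg0)).symm
      _ = _ := by rw [hg, integral_const_mul]; congr 1; ring
  rw [← lintegral_add_compl _ (Metric.isOpen_ball (x := (0 : E)) (ε := s)).measurableSet] at hnorm
  rw [ENNReal.ofReal_sub _ (by positivity), ENNReal.ofReal_one, tsub_le_iff_right, ← hnorm]
  gcongr

/-- Mass of a rescaled radial kernel on balls, with the explicit constant. -/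
theorem one_sub_le_setLIntegral_ball_rescaled {d : ℕ} (hd : 1 ≤ d) {κ : ℝ → ℝ}
    (hcont : ContinuousOn κ (Set.Ici 0))
    (hnorm : ∫⁻ x : EuclideanSpace ℝ (Fin d), ENNReal.ofReal (κ ‖x‖) = 1)
    {t₀ C ρ : ℝ} (ht₀ : 0 < t₀) (hC : 0 ≤ C) (hρ0 : 0 < ρ) (hρ1 : ρ ≤ 1)
    (htail : ∀ t : ℝ, t₀ < t → κ t ≤ C * Real.exp (-(t ^ ρ)))
    {h : ℝ} (hh : 0 < h) (x : EuclideanSpace ℝ (Fin d)) {r : ℝ} (hr : t₀ * h ≤ r) :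
    ENNReal.ofReal (1 - ρ⁻¹ * C *
        (Real.pi ^ ((d : ℝ) / 2) / Real.Gamma ((d : ℝ) / 2 + 1)) * 2 ^ (((d : ℝ) + 1) / ρ - 1) *
        (Nat.factorial (⌈(5 + (d : ℝ)) / ρ⌉₊ - 1) : ℝ) / (r / h) ^ 4) ≤
      ∫⁻ y in Metric.ball x r, ENNReal.ofReal (κ (‖x - y‖ / h) / h ^ d) := by
  have : Nonempty (Fin d) := ⟨⟨0, hd⟩⟩
  have hd' : (1 : ℝ) ≤ d := by exact_mod_cast hd
  have hs : t₀ ≤ r / h := (le_div_iff₀ hh).2 hr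
  have htail' : ∀ t, t₀ ≤ t → κ t ≤ C * Real.exp (-t ^ ρ) := by
    intro t ht
    have ht0 : 0 < t := ht₀.trans_le ht
    refine le_of_tendsto_of_tendsto (b := nhdsWithin t (Set.Ioi t)) (f := κ)
      (g := fun u ↦ C * Real.exp (-u ^ ρ)) ?_ ?_ ?_
    · exact (hcont t ht0.le).mono fun u hu ↦ ht0.le.trans (le_of_lt hu)
    · have : ContinuousAt (fun u : ℝ ↦ C * Real.exp (-u ^ ρ)) t :=
        ((Real.continuousAt_rpow_const t ρ (Or.inl ht0.ne')).neg.rexp).const_mul C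
      exact this.tendsto.mono_left nhdsWithin_le_nhds
    · filter_upwards [self_mem_nhdsWithin] with u hu using htail u (ht.trans_lt hu)
  rw [setLIntegral_ball_rescaled_radial κ hh]
  refine le_trans (ENNReal.ofReal_le_ofReal ?_)
    (one_sub_le_setLIntegral_ball_of_tail volume hnorm ht₀ hC hρ0 htail' 4 hs)
  have hball : (volume : Measure (EuclideanSpace ℝ (Fin d))).real (Metric.ball 0 1) =
      Real.pi ^ ((d : ℝ) / 2) / Real.Gamma ((d : ℝ) / 2 + 1) := by
    have hΓ : 0 < Real.Gamma ((d : ℝ) / 2 + 1) := Real.Gamma_pos_of_pos (by positivity)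
    rw [Measure.real, EuclideanSpace.volume_ball, Fintype.card_fin, ENNReal.ofReal_one, one_pow,
      one_mul, ENNReal.toReal_ofReal (by positivity), Real.sqrt_eq_rpow, ← Real.rpow_natCast,
      ← Real.rpow_mul Real.pi_pos.le]
    congr 2; ring
  have hvd : 0 ≤ Real.pi ^ ((d : ℝ) / 2) / Real.Gamma ((d : ℝ) / 2 + 1) := by
    rw [← hball]; exact measureReal_nonneg
  rw [(integrable_norm_pow_mul_exp_neg_norm_rpow volume 4 hρ0).2, hball,
    finrank_euclideanSpace_fin]
  have hpow : (d : ℝ) ≤ 2 ^ (((d : ℝ) + 1) / ρ - 1) := by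
    calc (d : ℝ) ≤ (2 : ℝ) ^ (d : ℝ) := by
          rw [Real.rpow_natCast]; exact_mod_cast Nat.lt_two_pow_self.le
      _ ≤ _ := by
          refine Real.rpow_le_rpow_of_exponent_le one_le_two ?_
          have : (d : ℝ) + 1 ≤ ((d : ℝ) + 1) / ρ := le_div_self (by positivity) hρ0 hρ1
          linarith
  have hΓ : Real.Gamma (((d : ℝ) + (4 : ℕ)) / ρ) ≤
      (Nat.factorial (⌈(5 + (d : ℝ)) / ρ⌉₊ - 1) : ℝ) := by
    refine Gamma_le_factorial_ceil_sub_one ?_ ?_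
    · have : (d : ℝ) + (4 : ℕ) ≤ ((d : ℝ) + (4 : ℕ)) / ρ := le_div_self (by positivity) hρ0 hρ1
      push_cast at this ⊢
      linarith
    · gcongr ?_ / _
      push_cast
      linarith
  have hΓ0 : 0 ≤ Real.Gamma (((d : ℝ) + (4 : ℕ)) / ρ) := Real.Gamma_nonneg_of_nonneg (by positivity)
  set v := Real.pi ^ ((d : ℝ) / 2) / Real.Gamma ((d : ℝ) / 2 + 1)
  have hmain := mul_le_mul_of_nonneg_left (mul_le_mul hpow hΓ hΓ0 (by positivity))
    (show 0 ≤ ρ⁻¹ * C * v by positivity)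
  refine sub_le_sub_left (div_le_div_of_nonneg_right ?_ (by positivity)) 1
  linarith

/-- Concentration of the kernel `K_h(x, y) = h^{−d} κ(‖x − y‖/h)` on balls:
`∫_{B(x,r)} K_h(x,y) dy ≥ 1 − C₁ k!/(r/h)⁴` whenever `r ≥ t₁ h`; in particular, for
`0 < h ≤ h₀`, taking `r = √h` gives `∫_{B(x,√h)} K_h(x,y) dy ≥ 1 − h`. -/
theorem stmt16 (d : ℕ) (hd : 1 ≤ d) (κ : ℝ → ℝ)
    (hκ0 : ∀ t : ℝ, 0 ≤ t → 0 ≤ κ t)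
    (hmono : AntitoneOn κ (Set.Ici 0))
    (hcont : ContinuousOn κ (Set.Ici 0))
    (hnorm : ∫⁻ x : EuclideanSpace ℝ (Fin d), ENNReal.ofReal (κ ‖x‖) = 1)
    (t0 Cρ ρ : ℝ) (ht0 : 1 ≤ t0) (hCρ : 0 < Cρ) (hρ0 : 0 < ρ) (hρ1 : ρ ≤ 1)
    (htail : ∀ t : ℝ, t0 < t → κ t ≤ Cρ * Real.exp (-(t ^ ρ)))
    (a t1 vd C1 : ℝ) (k : ℕ)
    (ha : a = ((d : ℝ) + 1) / ρ)
    (ht1 : t1 = max ((Real.Gamma (a + 1)) ^ (1 / (ρ * (a - 1)))) t0)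
    (hvd : vd = Real.pi ^ ((d : ℝ) / 2) / Real.Gamma ((d : ℝ) / 2 + 1))
    (hC1 : C1 = ρ⁻¹ * Cρ * vd * (2 : ℝ) ^ (a - 1))
    (hk : k = Nat.ceil ((5 + (d : ℝ)) / ρ) - 1) :
    (∀ h : ℝ, 0 < h → ∀ x : EuclideanSpace ℝ (Fin d), ∀ r : ℝ, t1 * h ≤ r →
      ENNReal.ofReal (1 - C1 * (Nat.factorial k : ℝ) / (r / h) ^ 4) ≤
        ∫⁻ y : EuclideanSpace ℝ (Fin d) in Metric.ball x r,
          ENNReal.ofReal (κ (‖x - y‖ / h) / h ^ d)) ∧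
    (∀ h : ℝ, 0 < h → h ≤ min (1 / (C1 * (Nat.factorial k : ℝ))) (1 / t1 ^ 2) →
      ∀ x : EuclideanSpace ℝ (Fin d),
      ENNReal.ofReal (1 - h) ≤
        ∫⁻ y : EuclideanSpace ℝ (Fin d) in Metric.ball x (Real.sqrt h),
          ENNReal.ofReal (κ (‖x - y‖ / h) / h ^ d)) := by
  have hmass : ∀ h : ℝ, 0 < h → ∀ x : EuclideanSpace ℝ (Fin d), ∀ r : ℝ, t1 * h ≤ r →
      ENNReal.ofReal (1 - C1 * (Nat.factorial k : ℝ) / (r / h) ^ 4) ≤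
        ∫⁻ y : EuclideanSpace ℝ (Fin d) in Metric.ball x r,
          ENNReal.ofReal (κ (‖x - y‖ / h) / h ^ d) := by
    intro h hh x r hr
    have ht : t0 * h ≤ r :=
      (mul_le_mul_of_nonneg_right (ht1 ▸ le_max_right _ _) hh.le).trans hr
    subst hC1 hk ha hvd
    exact one_sub_le_setLIntegral_ball_rescaled hd hcont hnorm (by linarith) hCρ.le hρ0 hρ1
      htail hh x ht
  refine ⟨hmass, fun h hh hle x ↦ ?_⟩
  have ht1pos : 0 < t1 := zero_lt_one.trans_le (ht0.trans (ht1 ▸ le_max_right _ _))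
  obtain ⟨hle1, hle2⟩ := le_min_iff.1 hle
  have hsq : Real.sqrt h ^ 2 = h := Real.sq_sqrt hh.le
  have hsqpos : 0 < Real.sqrt h := Real.sqrt_pos.2 hh
  have hts : t1 * Real.sqrt h ≤ 1 := by
    have : (t1 * Real.sqrt h) ^ 2 ≤ 1 := by
      rw [mul_pow, hsq, mul_comm]
      exact (le_div_iff₀ (by positivity)).1 hle2
    exact (sq_le_one_iff₀ (by positivity)).1 this
  have hr : t1 * h ≤ Real.sqrt h := by
    calc t1 * h = (t1 * Real.sqrt h) * Real.sqrt h := by rw [mul_assoc, ← sq, hsq]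
      _ ≤ 1 * Real.sqrt h := by gcongr
      _ = _ := one_mul _
  refine le_trans (ENNReal.ofReal_le_ofReal ?_) (hmass h hh x _ hr)
  have hCk : 0 < C1 * (Nat.factorial k : ℝ) := by
    by_contra! hneg
    exact absurd (hle1.trans (one_div_nonpos.2 hneg)) (not_le.2 hh)
  have hpow : (Real.sqrt h / h) ^ 4 = (h ^ 2)⁻¹ := by
    rw [div_pow, show Real.sqrt h ^ 4 = h ^ 2 by rw [show 4 = 2 * 2 by rfl, pow_mul, hsq]]
    field_simp
  rw [hpow, div_inv_eq_mul]
  have hk1 : h * (C1 * (Nat.factorial k : ℝ)) ≤ 1 := (le_div_iff₀ hCk).1 hle1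
  nlinarith [mul_le_mul_of_nonneg_left hk1 hh.le]
end

section
/- Fix d ≥ 1 and let S ⊆ ℝ^d be a measurable subset of the closed Euclidean ball of radius R with Lebesgue measure V_S = λ(S) ≥ 1, and define the boundary measure functional φ(r) = λ(S \ S_{−r}) / λ(S), where S_{−r} = { x ∈ S : B(x, r) ⊆ S }. Let κ : [0,∞) → [0,∞) be a non-increasing continuous function with ∫_{ℝ^d} κ(‖x‖₂) dx = 1, κ(0) ≤ c₀ for some c₀ > 0, and constants t₀ ≥ 1, C_ρ > 0, 0 < ρ ≤ 1 with κ(t) ≤ C_ρ exp(−t^ρ) for all t > t₀; set K_h(x, y) = h^{−d} κ(‖x − y‖₂/h), and let h₀ = min( 1/(C₁ k!), 1/t₁² ) with C₁, t₁, k as determined by κ and d via a = (d+1)/ρ, t₁ = max(Γ(a+1)^{1/(ρ(a−1))}, t₀), C₁ = ρ^{−1} C_ρ v_d 2^{a−1}, k = ⌈(5+d)/ρ⌉ − 1. Let p0 be a probability density supported on S with γ ≤ p0(x) ≤ 1/γ for all x ∈ S for a constant γ ∈ (0,1], and suppose |p0(x) − p0(y)| ≤ C_α ‖x − y‖^α for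 all x, y ∈ S and constants α, C_α > 0. Let q be a probability density supported on S. Then for every h ∈ (0, h₀), tv(K_h ⋆ q, p0) ≤ tv(q, p0) + V_S · ( C_α h^{α/2} + h + φ(√h)/γ ), where (K_h ⋆ q)(x) = ∫ q(y) K_h(x, y) dy. -/
open MeasureTheory ENNReal
open scoped BigOperators

/-- Total variation distance between densities: `tv(p, q) = (1/2) ∫ |p − q| dλ`. -/
noncomputable def tvDist {X : Type*} [MeasurableSpace X] (lam : Measure X)
    (p q : X → ℝ) : ℝ≥0∞ :=
  (∫⁻ x, ENNReal.ofReal |p x - q x| ∂lam) / 2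

/-- The `L¹` norm of a function of integral zero is at most twice the integral of any
nonnegative upper bound of its negative. -/
lemma integral_abs_le_of_neg_le {X : Type*} [MeasurableSpace X] {μ : Measure X} {u v : X → ℝ}
    (hu : Integrable u μ) (hv : Integrable v μ)
    (hu0 : ∫ x, u x ∂μ = 0) (hv0 : ∀ x, 0 ≤ v x) (huv : ∀ x, -u x ≤ v x) :
    ∫ x, |u x| ∂μ ≤ 2 * ∫ x, v x ∂μ := by
  calc
    _ ≤ ∫ x, u x + 2 * v x ∂μ := by
      refine integral_mono hu.abs (hu.add (hv.const_mul 2)) fun x => ?_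
      have h1 := hv0 x
      have h2 := huv x
      dsimp only
      rcases abs_cases (u x) with ⟨h, _⟩ | ⟨h, _⟩ <;> linarith
    _ = _ := by rw [integral_add hu (hv.const_mul 2), hu0, integral_const_mul, zero_add]

lemma integrable_mul_comp_sub {E : Type*} [NormedAddCommGroup E] [SecondCountableTopology E]
    [MeasurableSpace E] [BorelSpace E] {μ : Measure E} {f k : E → ℝ} (hf : Integrable f μ)
    (hkc : Continuous k) {c : ℝ}
    (hk0 : ∀ x, 0 ≤ k x) (hkb : ∀ x, k x ≤ c) (x : E) :
    Integrable (fun y => f y * k (x - y)) μ := by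
  refine hf.mul_bdd (c := c) (by fun_prop) (ae_of_all _ fun y => ?_)
  rw [Real.norm_of_nonneg (hk0 _)]
  exact hkb _

section Smoothing

variable {E : Type*} [NormedAddCommGroup E] [NormedSpace ℝ E] [FiniteDimensional ℝ E]
  [MeasurableSpace E] [BorelSpace E] {μ : Measure E} [μ.IsAddHaarMeasure] {f g k : E → ℝ}

lemma integrable_smoothing (hf : Integrable f μ) (hk : Integrable k μ) :
    Integrable (fun x => ∫ y, f y * k (x - y) ∂μ) μ :=
  hf.integrable_convolution (ContinuousLinearMap.mul ℝ ℝ) hk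

lemma integral_smoothing (hf : Integrable f μ) (hk : Integrable k μ) :
    ∫ x, ∫ y, f y * k (x - y) ∂μ ∂μ = (∫ x, f x ∂μ) * ∫ x, k x ∂μ :=
  integral_convolution (ContinuousLinearMap.mul ℝ ℝ) hf hk

/-- Smoothing by a probability kernel does not increase the `L¹` distance. -/
lemma integral_abs_smoothing_sub_le (hf : Integrable f μ) (hg : Integrable g μ)
    (hk : Integrable k μ) (hkc : Continuous k) {c : ℝ} (hk0 : ∀ x, 0 ≤ k x)
    (hkb : ∀ x, k x ≤ c) (hk1 : ∫ x, k x ∂μ = 1) :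
    ∫ x, |(∫ y, f y * k (x - y) ∂μ) - ∫ y, g y * k (x - y) ∂μ| ∂μ ≤
      ∫ x, |f x - g x| ∂μ := by
  have habs : Integrable (fun x => |f x - g x|) μ := (hf.sub hg).abs
  calc
    _ ≤ ∫ x, ∫ y, |f y - g y| * k (x - y) ∂μ ∂μ := by
      refine integral_mono ((integrable_smoothing hf hk).sub (integrable_smoothing hg hk)).abs
        (integrable_smoothing habs hk) fun x => ?_
      dsimp only
      rw [← integral_sub (integrable_mul_comp_sub hf hkc hk0 hkb x)
        (integrable_mul_comp_sub hg hkc hk0 hkb x)]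
      refine (abs_integral_le_integral_abs).trans_eq (integral_congr_ae (ae_of_all _ fun y => ?_))
      dsimp only
      rw [← sub_mul, abs_mul, abs_of_nonneg (hk0 (x - y))]
    _ = _ := by rw [integral_smoothing habs hk, hk1, mul_one]

lemma sub_smoothing_le_of_ball (hf : Integrable f μ) (hk : Integrable k μ) (hkc : Continuous k)
    {c δ r : ℝ} (hk0 : ∀ x, 0 ≤ k x) (hkb : ∀ x, k x ≤ c) (hk1 : ∫ x, k x ∂μ = 1)
    (hf0 : ∀ x, 0 ≤ f x) (x : E) (hδ : 0 ≤ δ) (hx : ∀ y ∈ Metric.ball x r, f x - f y ≤ δ) :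
    f x - ∫ y, f y * k (x - y) ∂μ ≤
      δ + f x * ∫ z, {z : E | r ≤ ‖z‖}.indicator k z ∂μ := by
  have hm : MeasurableSet {z : E | r ≤ ‖z‖} :=
    (isClosed_le continuous_const continuous_norm).measurableSet
  have hki : Integrable ({z : E | r ≤ ‖z‖}.indicator k) μ := hk.indicator hm
  have hkx : Integrable (fun y => k (x - y)) μ := hk.comp_sub_left x
  have hkix : Integrable (fun y => {z : E | r ≤ ‖z‖}.indicator k (x - y)) μ :=
    hki.comp_sub_left x
  have e1 : ∫ y, k (x - y) ∂μ = 1 := by rw [integral_sub_left_eq_self, hk1]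
  have e2 : ∫ y, {z : E | r ≤ ‖z‖}.indicator k (x - y) ∂μ =
      ∫ z, {z : E | r ≤ ‖z‖}.indicator k z ∂μ := integral_sub_left_eq_self _ _ _
  have e3 : f x = ∫ y, f x * k (x - y) ∂μ := by rw [integral_const_mul, e1, mul_one]
  calc
    _ = ∫ y, (f x * k (x - y) - f y * k (x - y)) ∂μ := by
      rw [integral_sub (hkx.const_mul _) (integrable_mul_comp_sub hf hkc hk0 hkb x), ← e3]
    _ ≤ ∫ y, (δ * k (x - y) + f x * {z : E | r ≤ ‖z‖}.indicator k (x - y)) ∂μ := by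
      refine integral_mono ((hkx.const_mul _).sub (integrable_mul_comp_sub hf hkc hk0 hkb x))
        ((hkx.const_mul _).add (hkix.const_mul _)) fun y => ?_
      dsimp only
      have h0 := hk0 (x - y)
      by_cases hy : r ≤ ‖x - y‖
      · rw [Set.indicator_of_mem (by exact hy)]
        nlinarith [mul_nonneg hδ h0, mul_nonneg (hf0 y) h0]
      · rw [Set.indicator_of_notMem (by exact hy), mul_zero, add_zero, ← sub_mul]
        refine mul_le_mul_of_nonneg_right (hx y ?_) h0
        rw [Metric.mem_ball, dist_comm, dist_eq_norm]
        exact not_le.mp hy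
    _ = _ := by
      rw [integral_add (hkx.const_mul _) (hkix.const_mul _), integral_const_mul,
        integral_const_mul, e1, e2, mul_one]

/-- Tail mass of a radial kernel with stretched exponential decay. -/
lemma integral_indicator_norm_le_of_exp_tail [Nontrivial E] {κ : ℝ → ℝ} {s C ρ : ℝ} (hs : 0 < s)
    (hC : 0 < C) (hρ : 0 < ρ) (htail : ∀ t, s ≤ t → κ t ≤ C * Real.exp (-(t ^ ρ)))
    (hκ : Integrable (fun x : E => κ ‖x‖) μ) :
    ∫ x, {x : E | s ≤ ‖x‖}.indicator (fun x => κ ‖x‖) x ∂μ ≤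
      C / s ^ 4 * (Module.finrank ℝ E * (μ.real (Metric.ball 0 1) *
        (1 / ρ * Real.Gamma ((Module.finrank ℝ E + 4) / ρ)))) := by
  have hm : MeasurableSet {z : E | s ≤ ‖z‖} :=
    (isClosed_le continuous_const continuous_norm).measurableSet
  have hd : 1 ≤ Module.finrank ℝ E := Module.finrank_pos
  have hcongr : Set.EqOn
      (fun y : ℝ => y ^ (Module.finrank ℝ E - 1) • (y ^ 4 * Real.exp (-(y ^ ρ))))
      (fun y : ℝ => y ^ (Module.finrank ℝ E + 3 : ℝ) * Real.exp (-(y ^ ρ))) (Set.Ioi 0) := by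
    intro y hy
    have e : (Module.finrank ℝ E + 3 : ℝ) = ((Module.finrank ℝ E - 1 + 4 : ℕ) : ℝ) := by
      push_cast [Nat.cast_sub hd]; ring
    dsimp only
    rw [e, Real.rpow_natCast, smul_eq_mul, pow_add, mul_assoc]
  have hq : (-1 : ℝ) < Module.finrank ℝ E + 3 := by
    have : (0 : ℝ) ≤ Module.finrank ℝ E := Nat.cast_nonneg _
    linarith
  have hint : Integrable (fun x : E => ‖x‖ ^ 4 * Real.exp (-(‖x‖ ^ ρ))) μ := by
    rw [integrable_fun_norm_addHaar μ (f := fun y : ℝ => y ^ 4 * Real.exp (-(y ^ ρ))),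
      integrableOn_congr_fun hcongr measurableSet_Ioi]
    exact integrableOn_rpow_mul_exp_neg_rpow hq hρ
  calc
    _ ≤ ∫ x : E, C / s ^ 4 * (‖x‖ ^ 4 * Real.exp (-(‖x‖ ^ ρ))) ∂μ := by
      refine integral_mono (hκ.indicator hm) (hint.const_mul _) fun x => ?_
      dsimp only
      by_cases hx : s ≤ ‖x‖
      · rw [Set.indicator_of_mem (by exact hx)]
        refine (htail _ hx).trans ?_
        have h1 : (1 : ℝ) ≤ ‖x‖ ^ 4 / s ^ 4 := by
          rw [one_le_div (by positivity)]
          gcongr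
        calc
          _ = C * Real.exp (-(‖x‖ ^ ρ)) * 1 := by ring
          _ ≤ C * Real.exp (-(‖x‖ ^ ρ)) * (‖x‖ ^ 4 / s ^ 4) := by gcongr
          _ = _ := by ring
      · rw [Set.indicator_of_notMem (by exact hx)]
        positivity
    _ = _ := by
      rw [integral_const_mul,
        integral_fun_norm_addHaar μ (fun y : ℝ => y ^ 4 * Real.exp (-(y ^ ρ))),
        setIntegral_congr_fun measurableSet_Ioi hcongr, integral_rpow_mul_exp_neg_rpow hρ hq,
        nsmul_eq_mul, smul_eq_mul]
      congr 6
      ring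

lemma integrable_dilation {F : E → ℝ} (hF : Integrable F μ) {h : ℝ} (hh : 0 < h) :
    Integrable (fun z => F (h⁻¹ • z) / h ^ Module.finrank ℝ E) μ :=
  (hF.comp_smul (inv_ne_zero hh.ne')).div_const _

lemma integral_dilation (F : E → ℝ) {h : ℝ} (hh : 0 < h) :
    ∫ z, F (h⁻¹ • z) / h ^ Module.finrank ℝ E ∂μ = ∫ z, F z ∂μ := by
  rw [integral_div, Measure.integral_comp_inv_smul, abs_of_pos (by positivity), smul_eq_mul,
    mul_div_cancel_left₀ _ (by positivity)]

end Smoothing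

lemma measurableSet_inner_parallel {E : Type*} [PseudoMetricSpace E] [MeasurableSpace E]
    [OpensMeasurableSpace E] {S : Set E} (hS : MeasurableSet S) (r : ℝ) :
    MeasurableSet {x ∈ S | Metric.ball x r ⊆ S} := by
  have : {x ∈ S | Metric.ball x r ⊆ S} = S ∩ (Metric.thickening r Sᶜ)ᶜ := by
    ext x
    simp only [Set.mem_ofPred_eq, Set.mem_inter_iff, Set.mem_compl_iff, Metric.mem_thickening_iff,
      not_exists, not_and, not_lt, Set.subset_def, Metric.mem_ball]
    refine and_congr_right fun _ => forall_congr' fun y => ?_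
    rw [dist_comm x y, ← not_lt]
    tauto
  rw [this]
  exact hS.inter Metric.isOpen_thickening.measurableSet.compl

lemma tvDist_eq_ofReal {X : Type*} [MeasurableSpace X] {lam : Measure X} {p q : X → ℝ}
    (hp : Integrable p lam) (hq : Integrable q lam) :
    tvDist lam p q = ENNReal.ofReal ((∫ x, |p x - q x| ∂lam) / 2) := by
  have habs : Integrable (fun x => |p x - q x|) lam := (hp.sub hq).abs
  rw [tvDist, ENNReal.ofReal_div_of_pos two_pos, ENNReal.ofReal_ofNat,
    ofReal_integral_eq_lintegral_ofReal habs (ae_of_all _ fun _ => abs_nonneg _)]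

lemma integrable_of_lintegral_eq_one {X : Type*} [MeasurableSpace X] {lam : Measure X}
    {f : X → ℝ} (hf : AEStronglyMeasurable f lam) (hf0 : ∀ x, 0 ≤ f x)
    (hf1 : ∫⁻ x, ENNReal.ofReal (f x) ∂lam = 1) : Integrable f lam ∧ ∫ x, f x ∂lam = 1 := by
  constructor
  · refine ⟨hf, ?_⟩
    rw [hasFiniteIntegral_iff_ofReal (ae_of_all _ hf0), hf1]
    exact ENNReal.one_lt_top
  · rw [integral_eq_lintegral_of_nonneg_ae (ae_of_all _ hf0) hf, hf1, ENNReal.toReal_one]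

lemma mul_Gamma_le_factorial {d : ℕ} {ρ : ℝ} (hρ0 : 0 < ρ) (hρ1 : ρ ≤ 1) :
    (d : ℝ) * Real.Gamma ((d + 4) / ρ) ≤
      (Nat.factorial (Nat.ceil ((5 + (d : ℝ)) / ρ) - 1) : ℝ) := by
  set n := Nat.ceil ((5 + (d : ℝ)) / ρ) with hn
  have hd : (0 : ℝ) ≤ d := Nat.cast_nonneg d
  have hle : (5 + (d : ℝ)) / ρ ≤ n := Nat.le_ceil _
  have hx : (d + 4 : ℝ) ≤ (d + 4) / ρ := by
    rw [le_div_iff₀ hρ0]; nlinarith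
  have hx1 : (d + 4 : ℝ) / ρ + 1 ≤ (5 + d) / ρ := by
    have : 1 ≤ 1 / ρ := by rw [le_div_iff₀ hρ0]; linarith
    have e : (5 + d : ℝ) / ρ = (d + 4) / ρ + 1 / ρ := by ring
    linarith
  have hn1 : 1 ≤ n := by
    have : (1 : ℝ) ≤ n := by linarith
    exact_mod_cast this
  have hpos : 0 < Real.Gamma ((d + 4) / ρ) := Real.Gamma_pos_of_pos (by positivity)
  calc
    _ ≤ ((d + 4) / ρ) * Real.Gamma ((d + 4) / ρ) := by gcongr; linarith
    _ = Real.Gamma ((d + 4) / ρ + 1) := (Real.Gamma_add_one (by positivity)).symm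
    _ ≤ Real.Gamma n := Real.Gamma_strictMonoOn_Ici.monotoneOn
      (by rw [Set.mem_Ici]; linarith) (by rw [Set.mem_Ici]; linarith) (hx1.trans hle)
    _ = _ := by
      rw [← Real.Gamma_nat_eq_factorial]
      congr 1
      push_cast [Nat.cast_sub hn1]
      ring


/-- Kernel smoothing of densities keeps the TV-distance to `p0` almost unchanged:
`tv(K_h ⋆ q, p0) ≤ tv(q, p0) + V_S (C_α h^{α/2} + h + φ(√h)/γ)` for `h ∈ (0, h₀)`. -/
theorem stmt17 (d : ℕ) (hd : 1 ≤ d) (R : ℝ)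
    (S : Set (EuclideanSpace ℝ (Fin d))) (hSm : MeasurableSet S)
    (hSR : S ⊆ Metric.closedBall 0 R)
    (hVS : 1 ≤ volume S)
    (κ : ℝ → ℝ)
    (hκ0 : ∀ t : ℝ, 0 ≤ t → 0 ≤ κ t)
    (hmono : AntitoneOn κ (Set.Ici 0))
    (hcont : ContinuousOn κ (Set.Ici 0))
    (hnorm : ∫⁻ x : EuclideanSpace ℝ (Fin d), ENNReal.ofReal (κ ‖x‖) = 1)
    (c0 : ℝ) (hc0 : 0 < c0) (hκc0 : κ 0 ≤ c0)
    (t0 Cρ ρ : ℝ) (ht0 : 1 ≤ t0) (hCρ : 0 < Cρ) (hρ0 : 0 < ρ) (hρ1 : ρ ≤ 1)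
    (htail : ∀ t : ℝ, t0 < t → κ t ≤ Cρ * Real.exp (-(t ^ ρ)))
    (a t1 vd C1 h0 : ℝ) (k : ℕ)
    (ha : a = ((d : ℝ) + 1) / ρ)
    (ht1 : t1 = max ((Real.Gamma (a + 1)) ^ (1 / (ρ * (a - 1)))) t0)
    (hvd : vd = Real.pi ^ ((d : ℝ) / 2) / Real.Gamma ((d : ℝ) / 2 + 1))
    (hC1 : C1 = ρ⁻¹ * Cρ * vd * (2 : ℝ) ^ (a - 1))
    (hk : k = Nat.ceil ((5 + (d : ℝ)) / ρ) - 1)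
    (hh0 : h0 = min (1 / (C1 * (Nat.factorial k : ℝ))) (1 / t1 ^ 2))
    (γ : ℝ) (hγ0 : 0 < γ) (hγ1 : γ ≤ 1)
    (p0 : EuclideanSpace ℝ (Fin d) → ℝ) (hp0m : Measurable p0)
    (hp0supp : ∀ x ∉ S, p0 x = 0)
    (hp0bd : ∀ x ∈ S, γ ≤ p0 x ∧ p0 x ≤ 1 / γ)
    (hp0int : ∫⁻ x, ENNReal.ofReal (p0 x) = 1)
    (α Cα : ℝ) (hα : 0 < α) (hCα : 0 < Cα)
    (hHolder : ∀ x ∈ S, ∀ y ∈ S, |p0 x - p0 y| ≤ Cα * ‖x - y‖ ^ α)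
    (q : EuclideanSpace ℝ (Fin d) → ℝ) (hqm : Measurable q) (hq0 : ∀ x, 0 ≤ q x)
    (hqsupp : ∀ x ∉ S, q x = 0) (hqint : ∫⁻ x, ENNReal.ofReal (q x) = 1)
    (h : ℝ) (hh : 0 < h) (hhh0 : h < h0) :
    tvDist volume (fun x => ∫ y, q y * (κ (‖x - y‖ / h) / h ^ d)) p0 ≤
      tvDist volume q p0 +
        ENNReal.ofReal ((volume S).toReal *
          (Cα * h ^ (α / 2) + h +
            (volume (S \ {x ∈ S | Metric.ball x (Real.sqrt h) ⊆ S})).toReal /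
              (volume S).toReal / γ)) := by
  have hs0 : 0 < √h := Real.sqrt_pos.mpr hh
  have hss : √h * √h = h := Real.mul_self_sqrt hh.le
  have : Nonempty (Fin d) := ⟨⟨0, hd⟩⟩
  have hfin : Module.finrank ℝ (EuclideanSpace ℝ (Fin d)) = d := by simp
  have hScl := Metric.isBounded_closedBall.subset hSR
  have hStop : volume S ≠ ⊤ := hScl.measure_lt_top.ne
  have hV1 : 1 ≤ (volume S).toReal := by
    rw [← ENNReal.toReal_one]; exact ENNReal.toReal_mono hStop hVS
  have hV0 : 0 < (volume S).toReal := by linarith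
  have hp00 : ∀ x, 0 ≤ p0 x := fun x => by
    by_cases hx : x ∈ S
    · exact hγ0.le.trans (hp0bd x hx).1
    · rw [hp0supp x hx]
  have hκn : Continuous fun x : EuclideanSpace ℝ (Fin d) => κ ‖x‖ :=
    hcont.comp_continuous continuous_norm fun x => norm_nonneg x
  obtain ⟨hκi, hκ1⟩ := integrable_of_lintegral_eq_one hκn.aestronglyMeasurable
    (fun x => hκ0 _ (norm_nonneg x)) hnorm
  obtain ⟨hpi, hp1⟩ := integrable_of_lintegral_eq_one hp0m.aestronglyMeasurable hp00 hp0int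
  obtain ⟨hqi, -⟩ := integrable_of_lintegral_eq_one hqm.aestronglyMeasurable hq0 hqint
  set K : EuclideanSpace ℝ (Fin d) → ℝ := fun z => κ (‖z‖ / h) / h ^ d with hK
  have hnh : ∀ z : EuclideanSpace ℝ (Fin d), ‖h⁻¹ • z‖ = ‖z‖ / h := fun z => by
    rw [norm_smul, norm_inv, Real.norm_of_nonneg hh.le, inv_mul_eq_div]
  have hKdil : K = fun z => κ ‖h⁻¹ • z‖ / h ^ Module.finrank ℝ (EuclideanSpace ℝ (Fin d)) := by
    funext z; rw [hK, hnh, hfin]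
  have hKi : Integrable K := by
    rw [hKdil]; exact integrable_dilation hκi hh
  have hK1 : ∫ z, K z = 1 := by
    rw [hKdil, ← hκ1]; exact integral_dilation (fun z => κ ‖z‖) hh
  have hKc : Continuous K :=
    (hcont.comp_continuous (continuous_norm.div_const h) fun x =>
      div_nonneg (norm_nonneg x) hh.le).div_const _
  have hK0 : ∀ z, 0 ≤ K z := fun z =>
    div_nonneg (hκ0 _ (div_nonneg (norm_nonneg z) hh.le)) (pow_nonneg hh.le d)
  have hKb : ∀ z, K z ≤ κ 0 / h ^ d := fun z =>
    div_le_div_of_nonneg_right (hmono Set.self_mem_Ici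
      (div_nonneg (norm_nonneg z) hh.le) (div_nonneg (norm_nonneg z) hh.le)) (pow_nonneg hh.le d)
  have hfact := mul_Gamma_le_factorial (d := d) hρ0 hρ1
  rw [← hk] at hfact
  have hvd0 : 0 < vd := by
    rw [hvd]
    exact div_pos (Real.rpow_pos_of_pos Real.pi_pos _) (Real.Gamma_pos_of_pos (by positivity))
  have hball : (volume : Measure (EuclideanSpace ℝ (Fin d))).real (Metric.ball 0 1) = vd := by
    rw [measureReal_def, EuclideanSpace.volume_ball, Fintype.card_fin, ENNReal.ofReal_one,
      one_pow, one_mul, hvd, Real.sqrt_eq_rpow, ← Real.rpow_natCast, ← Real.rpow_mul Real.pi_pos.le,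
      one_div_mul_eq_div]
    exact ENNReal.toReal_ofReal (div_pos (Real.rpow_pos_of_pos Real.pi_pos _)
      (Real.Gamma_pos_of_pos (by positivity))).le
  have ha1 : 1 ≤ a := by
    rw [ha, le_div_iff₀ hρ0]
    have : (0 : ℝ) ≤ d := Nat.cast_nonneg d
    linarith
  have hC1pos : 0 < C1 := by rw [hC1]; positivity
  have hCle : ρ⁻¹ * Cρ * vd ≤ C1 := by
    rw [hC1]
    exact le_mul_of_one_le_right (by positivity)
      (Real.one_le_rpow one_le_two (sub_nonneg.mpr ha1))
  rw [hh0, lt_min_iff] at hhh0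
  have hhC : h * (C1 * (Nat.factorial k : ℝ)) < 1 := (lt_div_iff₀ (by positivity)).mp hhh0.1
  have ht01 : t0 ≤ t1 := ht1 ▸ le_max_right _ _
  have ht1pos : 0 < t1 := by linarith
  have hst : t0 < 1 / √h := by
    refine ht01.trans_lt ((lt_div_iff₀ hs0).mpr ?_)
    have h2 : h * t1 ^ 2 < 1 := (lt_div_iff₀ (by positivity)).mp hhh0.2
    have h3 : (t1 * √h) ^ 2 < 1 := by rw [mul_pow, Real.sq_sqrt hh.le]; linarith
    nlinarith [mul_pos ht1pos hs0]
  have hτ : ∫ z, {z : EuclideanSpace ℝ (Fin d) | √h ≤ ‖z‖}.indicator K z ≤ h := by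
    have e : {z : EuclideanSpace ℝ (Fin d) | √h ≤ ‖z‖}.indicator K = fun z =>
        {x : EuclideanSpace ℝ (Fin d) | 1 / √h ≤ ‖x‖}.indicator (fun x => κ ‖x‖) (h⁻¹ • z) /
          h ^ Module.finrank ℝ (EuclideanSpace ℝ (Fin d)) := by
      funext z
      have hiff : √h ≤ ‖z‖ ↔ 1 / √h ≤ ‖h⁻¹ • z‖ := by
        rw [hnh, div_le_div_iff₀ hs0 hh, one_mul]
        nth_rewrite 2 [← hss]
        exact (mul_le_mul_iff_left₀ hs0).symm
      by_cases hz : √h ≤ ‖z‖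
      · rw [Set.indicator_of_mem (by exact hz), Set.indicator_of_mem (by exact hiff.mp hz), hKdil]
      · rw [Set.indicator_of_notMem (by exact hz),
          Set.indicator_of_notMem (by exact fun hz' => hz (hiff.mpr hz')), zero_div]
    rw [e, integral_dilation _ hh]
    refine (integral_indicator_norm_le_of_exp_tail (by positivity) hCρ hρ0
      (fun t ht => htail t (hst.trans_le ht)) hκi).trans ?_
    rw [hball, hfin]
    have e4 : (1 / √h) ^ 4 = 1 / h ^ 2 := by
      rw [div_pow, one_pow, show √h ^ 4 = (√h * √h) ^ 2 by ring, hss]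
    calc
      _ = h ^ 2 * ((ρ⁻¹ * Cρ * vd) * (d * Real.Gamma ((d + 4) / ρ))) := by
        rw [e4]; field_simp
      _ ≤ h ^ 2 * (C1 * (Nat.factorial k : ℝ)) := by gcongr
      _ = h * (h * (C1 * (Nat.factorial k : ℝ))) := by ring
      _ ≤ h * 1 := by gcongr
      _ = h := mul_one h
  set B : Set (EuclideanSpace ℝ (Fin d)) := S \ {x ∈ S | Metric.ball x (√h) ⊆ S}
  have hBm : MeasurableSet B := hSm.diff (measurableSet_inner_parallel hSm _)
  have hBtop : volume B ≠ ⊤ := measure_ne_top_of_subset Set.sdiff_subset hStop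
  set δ : ℝ := Cα * h ^ (α / 2) with hδ
  have hδ0 : 0 ≤ δ := by positivity
  set v : EuclideanSpace ℝ (Fin d) → ℝ := fun x =>
    S.indicator (fun _ => δ) x + h * p0 x + B.indicator (fun _ => 1 / γ) x with hv
  have hSi : Integrable (S.indicator fun _ => δ) :=
    (integrable_indicator_iff hSm).mpr (integrableOn_const hStop)
  have hBi : Integrable (B.indicator fun _ => 1 / γ) :=
    (integrable_indicator_iff hBm).mpr (integrableOn_const hBtop)
  have hvi : Integrable v := (hSi.add (hpi.const_mul h)).add hBi
  have hvint : ∫ x, v x = (volume S).toReal * δ + h + (volume B).toReal * (1 / γ) := by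
    have hSpi : Integrable fun x => S.indicator (fun _ => δ) x + h * p0 x :=
      hSi.add (hpi.const_mul h)
    rw [hv, integral_add hSpi hBi, integral_add hSi (hpi.const_mul h),
      integral_indicator_const _ hSm, integral_indicator_const _ hBm, integral_const_mul, hp1,
      mul_one, smul_eq_mul, smul_eq_mul, measureReal_def, measureReal_def]
  have hS0 : ∀ x, 0 ≤ S.indicator (fun _ => δ) x := Set.indicator_nonneg fun _ _ => hδ0
  have hB0 : ∀ x, 0 ≤ B.indicator (fun _ => 1 / γ) x :=
    Set.indicator_nonneg fun _ _ => by positivity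
  have hv0 : ∀ x, 0 ≤ v x := fun x =>
    add_nonneg (add_nonneg (hS0 x) (mul_nonneg hh.le (hp00 x))) (hB0 x)
  have hpK := integrable_smoothing hpi hKi
  have hqK := integrable_smoothing hqi hKi
  have hpK0 : ∀ x, 0 ≤ ∫ y, p0 y * K (x - y) := fun x =>
    integral_nonneg fun y => mul_nonneg (hp00 y) (hK0 _)
  have hbias : ∫ x, |(∫ y, p0 y * K (x - y)) - p0 x| ≤ 2 * ∫ x, v x := by
    refine integral_abs_le_of_neg_le (hpK.sub hpi) hvi ?_ hv0 fun x => ?_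
    · rw [integral_sub hpK hpi, integral_smoothing hpi hKi, hK1, hp1, mul_one, sub_self]
    · rw [neg_sub]
      by_cases hx : x ∈ S
      · by_cases hxb : Metric.ball x (√h) ⊆ S
        · refine (sub_smoothing_le_of_ball (r := √h) hpi hKi hKc hK0 hKb hK1 hp00 x hδ0
            fun y hy => ?_).trans ?_
          · refine (le_abs_self _).trans ((hHolder x hx y (hxb hy)).trans ?_)
            have hxy : ‖x - y‖ ≤ √h := by
              rw [← dist_eq_norm, dist_comm]; exact (Metric.mem_ball.mp hy).le
            rw [hδ, show h ^ (α / 2) = √h ^ α by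
              rw [Real.sqrt_eq_rpow, ← Real.rpow_mul hh.le]; congr 1; ring]
            gcongr
          · have := hB0 x
            have h2 := mul_le_mul_of_nonneg_left hτ (hp00 x)
            simp only [hv]
            rw [Set.indicator_of_mem hx]
            linarith
        · have hxB : x ∈ B := ⟨hx, fun h' => hxb h'.2⟩
          have h1 := hpK0 x
          have h2 := (hp0bd x hx).2
          have h3 := hS0 x
          have h4 := mul_nonneg hh.le (hp00 x)
          simp only [hv]
          rw [Set.indicator_of_mem hxB]
          linarith
      · have h1 := hpK0 x
        have h2 := hv0 x
        rw [hp0supp x hx]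
        linarith
  have hcontr := integral_abs_smoothing_sub_le hqi hpi hKi hKc hK0 hKb hK1
  have htri : ∫ x, |(∫ y, q y * K (x - y)) - p0 x| ≤
      (∫ x, |(∫ y, q y * K (x - y)) - ∫ y, p0 y * K (x - y)|) +
        ∫ x, |(∫ y, p0 y * K (x - y)) - p0 x| := by
    have hi1 : Integrable fun x => |(∫ y, q y * K (x - y)) - ∫ y, p0 y * K (x - y)| :=
      (hqK.sub hpK).abs
    have hi2 : Integrable fun x => |(∫ y, p0 y * K (x - y)) - p0 x| := (hpK.sub hpi).abs
    rw [← integral_add hi1 hi2]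
    exact integral_mono (hqK.sub hpi).abs (hi1.add hi2) fun x => abs_sub_le _ _ _
  have hfinal : ∫ x, v x ≤ (volume S).toReal *
      (δ + h + (volume B).toReal / (volume S).toReal / γ) := by
    have e : (volume S).toReal * (δ + h + (volume B).toReal / (volume S).toReal / γ) =
        (volume S).toReal * δ + (volume S).toReal * h + (volume B).toReal * (1 / γ) := by
      field_simp
    rw [hvint, e]
    have := mul_le_mul_of_nonneg_right hV1 hh.le
    linarith
  have hnonneg : 0 ≤ (volume S).toReal *
      (δ + h + (volume B).toReal / (volume S).toReal / γ) := by positivity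
  change tvDist volume (fun x => ∫ y, q y * K (x - y)) p0 ≤ _
  rw [tvDist_eq_ofReal hqK hpi, tvDist_eq_ofReal hqi hpi,
    ← ENNReal.ofReal_add (div_nonneg (integral_nonneg fun _ => abs_nonneg _) zero_le_two) hnonneg]
  exact ENNReal.ofReal_le_ofReal (by linarith)
end
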